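/- arXiv:2404.12928 — 8 statements merged into one kernel-verified Lean document; each statement's English description precedes it below -/
import Mathlib

section
/- Let N ≥ 2 and let z = (z_1,…,z_N), w = (w_1,…,w_N) ∈ ℝ^N be totally non-aligned, i.e. z_i·w_j − z_j·w_i ≠ 0 for all i ≠ j. Let σ : ℝ → ℝ be continuous. If there exists u ∈ ℝ^N with u ≠ 0 such that ∑_{i=1}^N u_i · σ(θ₁·z_i + θ₂·w_i) = 0 for every (θ₁, θ₂) ∈ ℝ², then σ is a polynomial function. -/
/-- Shifting along a direction orthogonal to `(z j, w j)` removes the `j`-th ridge function, so that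
each summand of a vanishing sum of ridge functions is annihilated by an iterated difference. -/
theorem fwdDiff_iter_eq_zero_of_ridge_sum_eq_zero {ι : Type*} [DecidableEq ι] {z w : ι → ℝ}
    (hzw : ∀ i j, i ≠ j → z i * w j - z j * w i ≠ 0) {k : ι} (hk : z k ≠ 0 ∨ w k ≠ 0)
    (S : Finset ι) (hkS : k ∉ S) (g : ι → ℝ → ℝ)
    (hg : ∀ a b : ℝ, g k (a * z k + b * w k) + ∑ i ∈ S, g i (a * z i + b * w i) = 0)
    (h x : ℝ) : (fwdDiff h)^[S.card] (g k) x = 0 := by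
  induction S using Finset.induction_on generalizing g x with
  | empty =>
    simp only [Finset.sum_empty, add_zero] at hg
    rcases hk with hz | hw
    · simpa [div_mul_cancel₀ x hz] using hg (x / z k) 0
    · simpa [div_mul_cancel₀ x hw] using hg 0 (x / w k)
  | insert j S hj ih =>
    simp only [Finset.mem_insert, not_or] at hkS
    rw [Finset.card_insert_of_notMem hj, Function.iterate_succ_apply]
    have hc := hzw j k (Ne.symm hkS.1)
    set t := h / (z j * w k - z k * w j) with ht
    have hk_shift : t * (z j * w k - z k * w j) = h := div_mul_cancel₀ h hc
    have key := ih hkS.2 (fun i ↦ fwdDiff (t * (z j * w i - z i * w j)) (g i)) ?_ x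
    · simpa only [hk_shift] using key
    · intro a b
      have h₁ := hg (a - t * w j) (b + t * z j)
      have h₂ := hg a b
      rw [Finset.sum_insert hj] at h₁ h₂
      have hshift : ∀ i, (a - t * w j) * z i + (b + t * z j) * w i =
          a * z i + b * w i + t * (z j * w i - z i * w j) := fun i ↦ by ring
      simp only [hshift] at h₁
      simp only [fwdDiff, Finset.sum_sub_distrib]
      simp only [sub_self, mul_zero, add_zero, mul_comm (z j) (w j)] at h₁
      have hjj : t * (w j * z j - w j * z j) = 0 := by ring
      linarith

/-- Newton interpolation: a function annihilated by an iterated difference of step `h` agrees with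
a polynomial on each arithmetic progression of step `h`. -/
theorem exists_polynomial_eval_eq_of_fwdDiff_iter_eq_zero {f : ℝ → ℝ} {h : ℝ} (hh : h ≠ 0) {m : ℕ}
    (hf : ∀ x, (fwdDiff h)^[m] f x = 0) (y : ℝ) :
    ∃ p : Polynomial ℝ, ∀ n : ℕ, f (y + n * h) = p.eval (y + n * h) := by
  have hf' : ∀ k, m ≤ k → (fwdDiff h)^[k] f y = 0 := by
    intro k hk
    obtain ⟨l, rfl⟩ := Nat.exists_eq_add_of_le' hk
    rw [Function.iterate_add_apply, show (fwdDiff h)^[m] f = fun _ ↦ 0 from funext hf]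
    have hz : ∀ l, (fwdDiff h)^[l] (fun _ : ℝ ↦ (0 : ℝ)) = fun _ ↦ 0 := by
      intro l
      induction l with
      | zero => rfl
      | succ l ih => rw [Function.iterate_succ_apply, fwdDiff_const]; exact ih
    rw [hz]
  refine ⟨(∑ k ∈ Finset.range m, Polynomial.C ((fwdDiff h)^[k] f y / (k.factorial : ℝ)) *
    descPochhammer ℝ k).comp (Polynomial.C h⁻¹ * (Polynomial.X - Polynomial.C y)), fun n ↦ ?_⟩
  have hn : h⁻¹ * (y + n * h - y) = n := by field_simp; ring
  have newton := shift_eq_sum_fwdDiff_iter h f n y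
  rw [nsmul_eq_mul] at newton
  rw [Polynomial.eval_comp, newton]
  simp only [Polynomial.eval_mul, Polynomial.eval_C, Polynomial.eval_sub, Polynomial.eval_X, hn,
    Polynomial.eval_finsetSum, descPochhammer_eval_eq_descFactorial,
    Nat.descFactorial_eq_factorial_mul_choose, Nat.cast_mul, nsmul_eq_mul]
  have hl : Finset.range (n + 1) ⊆ Finset.range (n + 1 + m) :=
    Finset.range_subset_range.2 (by omega)
  have hr : Finset.range m ⊆ Finset.range (n + 1 + m) := Finset.range_subset_range.2 (by omega)
  rw [Finset.sum_subset hl, Finset.sum_subset hr]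
  · refine Finset.sum_congr rfl fun k _ ↦ ?_
    have : (k.factorial : ℝ) ≠ 0 := by positivity
    field_simp
  · intro k _ hk
    simp [hf' k (by simpa using hk)]
  · intro k _ hk
    have hnk : n < k := not_lt.1 (mt Finset.mem_range.2 hk)
    simp [Nat.choose_eq_zero_of_lt hnk]

theorem exists_polynomial_eval_eq_on_Ici {f : ℝ → ℝ} (hc : Continuous f) {m : ℕ}
    (hf : ∀ h x, (fwdDiff h)^[m] f x = 0) (y : ℝ) :
    ∃ p : Polynomial ℝ, ∀ x, y ≤ x → f x = p.eval x := by
  obtain ⟨p, hp⟩ := exists_polynomial_eval_eq_of_fwdDiff_iter_eq_zero one_ne_zero (hf 1) y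
  refine ⟨p, fun x hx ↦ ?_⟩
  have hgrid : ∀ q : ℕ, q ≠ 0 → ∀ n : ℕ, f (y + n / q) = p.eval (y + n / q) := by
    intro q hq n
    have hq' : (q : ℝ) ≠ 0 := Nat.cast_ne_zero.2 hq
    obtain ⟨r, hr⟩ := exists_polynomial_eval_eq_of_fwdDiff_iter_eq_zero (inv_ne_zero hq')
      (hf (q : ℝ)⁻¹) y
    have hpr : p = r := by
      refine Polynomial.eq_of_infinite_eval_eq p r
        ((Set.infinite_range_of_injective (f := fun n : ℕ ↦ y + n) ?_).mono ?_)
      · intro a b hab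
        simpa using hab
      · rintro _ ⟨a, rfl⟩
        have h₁ := hp a
        have h₂ := hr (a * q)
        rw [Nat.cast_mul, mul_inv_cancel_right₀ hq'] at h₂
        rw [mul_one] at h₁
        exact h₁.symm.trans h₂
    rw [hpr, div_eq_mul_inv]
    exact hr n
  have hlim : Filter.Tendsto (fun q : ℕ ↦ y + (⌊(x - y) * q⌋₊ : ℝ) / q) Filter.atTop (nhds x) := by
    have := ((tendsto_nat_floor_mul_div_atTop (sub_nonneg.2 hx)).comp
      (tendsto_natCast_atTop_atTop (R := ℝ))).const_add y
    simpa [Function.comp_def] using this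
  refine tendsto_nhds_unique ((hc.tendsto x).comp hlim)
    (((p.continuous.tendsto x).comp hlim).congr' ?_)
  filter_upwards [Filter.eventually_ne_atTop 0] with q hq
  exact (hgrid q hq _).symm

/-- Fréchet's theorem: a continuous function annihilated by all differences of a given order is a
polynomial function. -/
theorem exists_polynomial_eval_eq_of_forall_fwdDiff_iter_eq_zero {f : ℝ → ℝ} (hc : Continuous f)
    {m : ℕ} (hf : ∀ h x, (fwdDiff h)^[m] f x = 0) :
    ∃ p : Polynomial ℝ, ∀ x, f x = p.eval x := by
  obtain ⟨p, hp⟩ := exists_polynomial_eval_eq_on_Ici hc hf 0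
  refine ⟨p, fun x ↦ ?_⟩
  obtain ⟨r, hr⟩ := exists_polynomial_eval_eq_on_Ici hc hf x
  have hpr : p = r := Polynomial.eq_of_infinite_eval_eq p r <|
    (Set.Ici_infinite (max 0 x)).mono fun t ht ↦ by
      have ht := max_le_iff.1 (Set.mem_Ici.1 ht)
      exact (hp t ht.1).symm.trans (hr t ht.2)
  rw [hpr]
  exact hr x le_rfl

theorem stmt0 (N : ℕ) (hN : 2 ≤ N) (z w : Fin N → ℝ)
    (hzw : ∀ i j : Fin N, i ≠ j → z i * w j - z j * w i ≠ 0)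
    (σ : ℝ → ℝ) (hσ : Continuous σ)
    (u : Fin N → ℝ) (hu : u ≠ 0)
    (hsum : ∀ θ₁ θ₂ : ℝ, ∑ i, u i * σ (θ₁ * z i + θ₂ * w i) = 0) :
    ∃ p : Polynomial ℝ, ∀ x : ℝ, σ x = p.eval x := by
  obtain ⟨k, hk⟩ := Function.ne_iff.1 hu
  have : Nontrivial (Fin N) := Fin.nontrivial_iff_two_le.2 hN
  obtain ⟨j, hj⟩ := exists_ne k
  have hzk : z k ≠ 0 ∨ w k ≠ 0 := by
    by_contra! h
    exact hzw k j hj.symm (by simp [h.1, h.2])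
  refine exists_polynomial_eval_eq_of_forall_fwdDiff_iter_eq_zero hσ
    (m := (Finset.univ.erase k).card) fun h x ↦ ?_
  have key := fwdDiff_iter_eq_zero_of_ridge_sum_eq_zero hzw hzk (Finset.univ.erase k)
    (Finset.notMem_erase k _) (fun i ↦ u i • σ) (fun a b ↦ by
      simpa [Finset.add_sum_erase _ (fun i ↦ u i * σ (a * z i + b * w i)) (Finset.mem_univ k)]
        using hsum a b) h x
  rw [fwdDiff_iter_const_smul] at key
  exact (mul_eq_zero.1 key).resolve_left hk
end

section
/- Let n ≥ 1 be a natural number and let f : ℝ → ℝ be a continuous function such that Δ^n_h f(x) = 0 for all x ∈ ℝ and all h ∈ ℝ. Then f is a polynomial function of degree at most n − 1, i.e. there exists a real polynomial p ∈ ℝ[X] with deg p < n and f(x) = p(x) for all x ∈ ℝ. -/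
/-- The finite difference operator: `(Δ_h f)(x) = f(x + h) - f(x)`. -/
def fdiff (h : ℝ) (f : ℝ → ℝ) : ℝ → ℝ := fun x => f (x + h) - f x

open Polynomial in
/-- **Newton's forward difference formula** in polynomial form: along an arithmetic progression,
a function annihilated by the `n`-th difference with that step agrees with a polynomial of degree
less than `n`. -/
theorem exists_polynomial_eq_of_fwdDiff_iter_eq_zero {K : Type*} [Field K] [CharZero K]
    {n : ℕ} {h : K} (hh : h ≠ 0) {f : K → K} (hf : (fwdDiff h)^[n] f = 0) (x : K) :
    ∃ p : K[X], p.degree < n ∧ ∀ k : ℕ, f (x + k * h) = p.eval (x + k * h) := by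
  refine ⟨∑ j ∈ Finset.range n, C ((fwdDiff h)^[j] f x / (j.factorial : K)) *
    (descPochhammer K j).comp (C h⁻¹ * (X - C x)), ?_, fun k => ?_⟩
  · refine (degree_sum_le _ _).trans_lt
      ((Finset.sup_lt_iff (WithBot.bot_lt_coe n)).2 fun j hj => ?_)
    refine (degree_le_of_natDegree_le ?_).trans_lt (Nat.cast_lt.2 (Finset.mem_range.1 hj))
    refine (natDegree_C_mul_le _ _).trans (natDegree_comp_le.trans ?_)
    rw [descPochhammer_natDegree]
    refine (Nat.mul_le_mul_left j ((natDegree_C_mul_le _ _).trans ?_)).trans_eq (mul_one j)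
    exact (natDegree_X_sub_C x).le
  · have hzero : ∀ j, n ≤ j → (fwdDiff h)^[j] f x = 0 := by
      intro j hj
      obtain ⟨m, rfl⟩ := Nat.exists_eq_add_of_le' hj
      rw [Function.iterate_add_apply, hf,
        Function.iterate_fixed (f := fwdDiff h) (x := (0 : K → K)) (fwdDiff_const h 0),
        Pi.zero_apply]
    have hsum := shift_eq_sum_fwdDiff_iter h f k x
    rw [nsmul_eq_mul] at hsum
    rw [hsum, eval_finsetSum]
    trans ∑ j ∈ Finset.range (k + 1 + n), k.choose j • (fwdDiff h)^[j] f x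
    · refine Finset.sum_subset (Finset.range_subset_range.2 (Nat.le_add_right _ _)) fun j _ hj => ?_
      rw [Nat.choose_eq_zero_of_lt (by simpa using hj), zero_smul]
    · symm
      refine Finset.sum_subset_zero_on_sdiff (Finset.range_subset_range.2 (Nat.le_add_left _ _))
        (fun j hj => ?_) fun j _ => ?_
      · rw [hzero j (by simpa using (Finset.mem_sdiff.1 hj).2), smul_zero]
      · have : h⁻¹ * (x + k * h - x) = k := by field_simp; ring
        simp only [eval_mul, eval_C, eval_comp, eval_sub, eval_X, this,
          descPochhammer_eval_eq_descFactorial, nsmul_eq_mul,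
          Nat.descFactorial_eq_factorial_mul_choose]
        have := Nat.cast_ne_zero (R := K).2 j.factorial_ne_zero
        push_cast
        field_simp

theorem stmt1 (n : ℕ) (hn : 1 ≤ n) (f : ℝ → ℝ) (hf : Continuous f)
    (hΔ : ∀ x h : ℝ, (fdiff h)^[n] f x = 0) :
    ∃ p : Polynomial ℝ, p.degree < n ∧ ∀ x : ℝ, f x = p.eval x := by
  have hΔ' (h : ℝ) : (fwdDiff h)^[n] f = 0 := funext fun x => hΔ x h
  obtain ⟨p, hp, hpf⟩ :=
    exists_polynomial_eq_of_fwdDiff_iter_eq_zero one_ne_zero (hΔ' 1) 0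
  simp only [zero_add, mul_one] at hpf
  refine ⟨p, hp, congrFun (Rat.denseRange_cast.equalizer hf p.continuous (funext fun q => ?_))⟩
  -- Compare `p` with the Newton polynomial of `f` along `-m, -m + 1 / q.den, -m + 2 / q.den, …`,
  -- a progression that contains `q` and all natural numbers.
  have hd : (q.den : ℝ) ≠ 0 := Nat.cast_ne_zero.2 q.den_ne_zero
  set m : ℕ := q.num.natAbs
  obtain ⟨r, hr, hrf⟩ :=
    exists_polynomial_eq_of_fwdDiff_iter_eq_zero (inv_ne_zero hd) (hΔ' (q.den : ℝ)⁻¹) (-m)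
  have hrp : r = p := by
    refine Polynomial.eq_of_degrees_lt_of_eval_index_eq (v := fun i : ℕ => (i : ℝ))
      (Finset.range n) Nat.cast_injective.injOn (by simpa using hr) (by simpa using hp)
      fun i _ => ?_
    have hi : (-m + ((m + i) * q.den : ℕ) * (q.den : ℝ)⁻¹ : ℝ) = i := by
      push_cast; field_simp; ring
    rw [← hpf i, ← hi, ← hrf]
  have hnum : 0 ≤ q.num + m * q.den := by
    have : (m : ℤ) ≤ m * q.den := le_mul_of_one_le_right (by positivity) (mod_cast q.den_pos)
    omega
  have hq : (-m + ((q.num + m * q.den).toNat : ℕ) * (q.den : ℝ)⁻¹ : ℝ) = q := by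
    have hcast : (((q.num + m * q.den).toNat : ℕ) : ℝ) = q.num + m * q.den := by
      exact_mod_cast congrArg (Int.cast (R := ℝ)) (Int.toNat_of_nonneg hnum)
    rw [hcast, Rat.cast_def]
    field_simp
    ring
  rw [Function.comp_apply, Function.comp_apply, ← hrp, ← hq, ← hrf]
end

section
/- Let n ≥ 1 be a natural number and let f : ℝ → ℝ be continuous on (0, ∞) and satisfy Δ^n_h f(x) = 0 for all x > 0 and all h > 0. Then there exists a real polynomial p ∈ ℝ[X] with deg p < n such that f(x) = p(x) for all x > 0. -/
theorem fdiff_eq_fwdDiff (h : ℝ) : fdiff h = fwdDiff h := rfl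

theorem fwdDiff_iter_eq_zero_of_forall_le {g : ℝ → ℝ} {h y : ℝ} {k : ℕ}
    (hg : ∀ i ≤ k, g (y + i • h) = 0) : (fwdDiff h)^[k] g y = 0 := by
  rw [fwdDiff_iter_eq_sum_shift]
  refine Finset.sum_eq_zero fun i hi => ?_
  rw [hg i (Nat.lt_succ_iff.mp (Finset.mem_range.mp hi)), smul_zero]

/-- A function whose `n`-th differences of step `h` vanish along an arithmetic progression, and
which vanishes at its first `n` terms, vanishes along the whole progression. -/
theorem eq_zero_of_fwdDiff_iter_eq_zero {g : ℝ → ℝ} {h y : ℝ} {n : ℕ}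
    (hΔ : ∀ i : ℕ, (fwdDiff h)^[n] g (y + i • h) = 0)
    (hg : ∀ i < n, g (y + i • h) = 0) (k : ℕ) : g (y + k • h) = 0 := by
  rw [shift_eq_sum_fwdDiff_iter h g k y]
  refine Finset.sum_eq_zero fun j _ => ?_
  suffices (fwdDiff h)^[j] g y = 0 by rw [this, smul_zero]
  rcases lt_or_ge j n with hj | hj
  · exact fwdDiff_iter_eq_zero_of_forall_le fun i hi => hg i (hi.trans_lt hj)
  · obtain ⟨d, rfl⟩ := Nat.exists_eq_add_of_le' hj
    rw [Function.iterate_add_apply]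
    exact fwdDiff_iter_eq_zero_of_forall_le fun i _ => hΔ i

theorem fwdDiff_iter_eval_eq_zero {p : Polynomial ℝ} {n : ℕ} (hp : p.degree < n) (h x : ℝ) :
    (fwdDiff h)^[n] (fun t => p.eval t) x = 0 := by
  induction n generalizing p with
  | zero => simp [Polynomial.degree_eq_bot.mp (Nat.WithBot.lt_zero_iff.mp (by simpa using hp))]
  | succ n ih =>
    have hstep : fwdDiff h (fun t => p.eval t) = fun t => (p.taylor h - p).eval t := by
      ext t
      simp [fwdDiff, Polynomial.taylor_eval, add_comm]
    rw [Function.iterate_succ_apply, hstep]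
    refine ih ?_
    rcases eq_or_ne p 0 with rfl | hp0
    · simp
    · have hlt : (p.taylor h - p).degree < p.degree := by
        simpa using Polynomial.degree_sub_lt_left (Polynomial.degree_taylor p h)
          (by simpa using hp0) (Polynomial.leadingCoeff_taylor h p)
      exact hlt.trans_le (Polynomial.degree_le_of_natDegree_le
        (Nat.lt_succ_iff.mp ((Polynomial.natDegree_lt_iff_degree_lt hp0).mpr hp)))

/-- On the progression `h, 2h, 3h, …` a function with vanishing `n`-th differences of step `h` is
a polynomial of degree less than `n`. -/
theorem exists_polynomial_eq_on_multiples {f : ℝ → ℝ} {n : ℕ} {h : ℝ} (hh : 0 < h)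
    (hΔ : ∀ x, 0 < x → (fwdDiff h)^[n] f x = 0) :
    ∃ p : Polynomial ℝ, p.degree < n ∧ ∀ k : ℕ, f (h + k • h) = p.eval (h + k • h) := by
  let v : ℕ → ℝ := fun i => h + i • h
  have hv : Set.InjOn v (Finset.range n) := fun a _ b _ hab => by
    simpa [v, hh.ne'] using hab
  let p := Lagrange.interpolate (Finset.range n) v (fun i => f (v i))
  have hp : p.degree < n := by
    simpa only [Finset.card_range] using Lagrange.degree_interpolate_lt (fun i => f (v i)) hv
  refine ⟨p, hp, fun k => sub_eq_zero.mp ?_⟩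
  refine eq_zero_of_fwdDiff_iter_eq_zero (g := f - fun t => p.eval t) (n := n)
    (fun i => ?_) (fun i hi => ?_) k
  · have : (fwdDiff h)^[n] (f - fun t => p.eval t) =
        (fwdDiff h)^[n] f - (fwdDiff h)^[n] (fun t => p.eval t) := by
      simpa [fwdDiff_aux.coe_fwdDiffₗ_pow] using
        map_sub ((fwdDiff_aux.fwdDiffₗ ℝ ℝ h) ^ n) f (fun t => p.eval t)
    rw [this, Pi.sub_apply, hΔ _ (by positivity), fwdDiff_iter_eval_eq_zero hp, sub_zero]
  · exact sub_eq_zero.mpr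
      (Lagrange.eval_interpolate_at_node (fun i => f (v i)) hv (Finset.mem_range.mpr hi)).symm

theorem Ioi_subset_closure_fractions :
    Set.Ioi (0 : ℝ) ⊆ closure {x | ∃ k m : ℕ, 0 < m ∧ x = ((k + 1 : ℕ) : ℝ) / m} := by
  refine (Rat.denseRange_cast.open_subset_closure_inter isOpen_Ioi).trans (closure_mono ?_)
  rintro _ ⟨hx, q, rfl⟩
  have hq : 0 < q.num := Rat.num_pos.mpr (by exact_mod_cast Set.mem_Ioi.mp hx)
  refine ⟨q.num.toNat - 1, q.den, q.den_pos, ?_⟩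
  rw [Nat.sub_add_cancel (by lia), Rat.cast_def]
  congr 1
  exact_mod_cast (Int.toNat_of_nonneg hq.le).symm

theorem stmt2 (n : ℕ) (hn : 1 ≤ n) (f : ℝ → ℝ)
    (hf : ContinuousOn f (Set.Ioi (0 : ℝ)))
    (hΔ : ∀ x : ℝ, 0 < x → ∀ h : ℝ, 0 < h → (fdiff h)^[n] f x = 0) :
    ∃ p : Polynomial ℝ, p.degree < n ∧ ∀ x : ℝ, 0 < x → f x = p.eval x := by
  have hpoly (h : ℝ) (hh : 0 < h) :=
    exists_polynomial_eq_on_multiples hh fun x hx => fdiff_eq_fwdDiff h ▸ hΔ x hx h hh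
  obtain ⟨p, hp, hpf⟩ := hpoly 1 one_pos
  refine ⟨p, hp, fun x hx => ?_⟩
  refine Set.EqOn.of_subset_closure (t := Set.Ioi (0 : ℝ)) (g := fun t => p.eval t) ?_ hf
    p.continuous.continuousOn ?_ Ioi_subset_closure_fractions hx
  · rintro _ ⟨k, m, hm, rfl⟩
    have hm' : (0 : ℝ) < m := by exact_mod_cast hm
    obtain ⟨q, hq, hqf⟩ := hpoly (1 / m) (by positivity)
    have hqp : q = p := by
      refine Polynomial.eq_of_degrees_lt_of_eval_index_eq (Finset.range n)
        (v := fun i : ℕ => (1 : ℝ) + i • 1) (fun a _ b _ hab => by simpa using hab)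
        (by simpa using hq) (by simpa using hp) fun i _ => ?_
      have hi : (1 : ℝ) + i • 1 = 1 / m + (m * (i + 1) - 1 : ℕ) • (1 / m) := by
        rw [nsmul_eq_mul, nsmul_eq_mul, Nat.cast_sub (Nat.mul_pos hm i.succ_pos)]
        push_cast
        field_simp
        simp; ring
      rw [← hpf i, hi, hqf]
    have hk : ((k + 1 : ℕ) : ℝ) / m = 1 / m + k • (1 / m) := by
      rw [nsmul_eq_mul]; push_cast; ring
    rw [hk, hqf k, hqp]
  · rintro _ ⟨k, m, hm, rfl⟩
    have hm' : (0 : ℝ) < m := by exact_mod_cast hm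
    exact Set.mem_Ioi.mpr (by positivity)
end

section
/- Let N ≥ 2 and let z = (z_1,…,z_N), w = (w_1,…,w_N) ∈ ℝ^N be totally non-aligned, i.e. z_i·w_j − z_j·w_i ≠ 0 for all i ≠ j. Let σ : ℝ → ℝ be continuous and suppose there exists u ∈ ℝ^N with u_i ≠ 0 for all i such that ∑_{i=1}^N u_i · σ(θ₁·z_i + θ₂·w_i) = 0 for every (θ₁, θ₂) ∈ ℝ². Then Δ^{N−1}_{h⃗} σ(x) = 0 for every x ∈ ℝ and every increment vector h⃗ = (h_1, …, h_{N−1}) ∈ ℝ^{N−1}. -/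
/-- The mixed finite difference `Δ^n_{h⃗} f = Δ_{h_n} ∘ ⋯ ∘ Δ_{h_1} f` for an
increment vector `h⃗ = (h_1, …, h_n)`. -/
def mdiff : (n : ℕ) → (Fin n → ℝ) → (ℝ → ℝ) → (ℝ → ℝ)
  | 0, _, f => f
  | n + 1, h, f => fdiff (h (Fin.last n)) (mdiff n (fun i => h i.castSucc) f)

/-- A mixed finite difference with a vanishing increment is zero. -/
theorem mdiff_eq_zero_of_increment_eq_zero (f : ℝ → ℝ) (n : ℕ) (h : Fin n → ℝ) (j : Fin n)
    (hj : h j = 0) (x : ℝ) : mdiff n h f x = 0 := by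
  induction n generalizing x with
  | zero => exact j.elim0
  | succ n ih =>
    simp only [mdiff, fdiff]
    induction j using Fin.lastCases with
    | last => simp [hj]
    | cast j => simp [ih (fun i => h i.castSucc) j hj]

/-- Differencing a linear relation between the ridge functions `θ ↦ σ (θ₁ zᵢ + θ₂ wᵢ)` in `θ`
along the directions `(a j, b j)`. -/
theorem sum_mul_mdiff_eq_zero {ι : Type*} [Fintype ι] {z w u : ι → ℝ} {σ : ℝ → ℝ}
    (hsum : ∀ θ₁ θ₂ : ℝ, ∑ i, u i * σ (θ₁ * z i + θ₂ * w i) = 0)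
    (n : ℕ) (a b : Fin n → ℝ) (θ₁ θ₂ : ℝ) :
    ∑ i, u i * mdiff n (fun j => a j * z i + b j * w i) σ (θ₁ * z i + θ₂ * w i) = 0 := by
  induction n generalizing θ₁ θ₂ with
  | zero => exact hsum θ₁ θ₂
  | succ n ih =>
    have ih' := ih (fun j => a j.castSucc) (fun j => b j.castSucc)
    simp only [mdiff, fdiff, mul_sub, Finset.sum_sub_distrib]
    rw [ih' θ₁ θ₂, sub_zero, ← ih' (θ₁ + a (Fin.last n)) (θ₂ + b (Fin.last n))]
    refine Finset.sum_congr rfl fun i _ => ?_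
    congr 2
    ring

theorem stmt5 (N : ℕ) (hN : 2 ≤ N) (z w : Fin N → ℝ)
    (hzw : ∀ i j : Fin N, i ≠ j → z i * w j - z j * w i ≠ 0)
    (σ : ℝ → ℝ) (hσ : Continuous σ)
    (u : Fin N → ℝ) (hu : ∀ i, u i ≠ 0)
    (hsum : ∀ θ₁ θ₂ : ℝ, ∑ i, u i * σ (θ₁ * z i + θ₂ * w i) = 0) :
    ∀ (hv : Fin (N - 1) → ℝ) (x : ℝ), mdiff (N - 1) hv σ x = 0 := by
  obtain _ | n := N
  · omega
  change ∀ (hv : Fin n → ℝ) (x : ℝ), mdiff n hv σ x = 0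
  intro hv x
  have hd (j : Fin n) : w j.succ * z 0 - z j.succ * w 0 ≠ 0 := by
    convert hzw 0 j.succ (Fin.succ_ne_zero j).symm using 1
    ring
  -- The direction `(w j, -z j)` leaves the argument of the `j`-th term unchanged.
  let t (j : Fin n) : ℝ := hv j / (w j.succ * z 0 - z j.succ * w 0)
  let j₀ : Fin n := ⟨0, by omega⟩
  let s : ℝ := x / (w j₀.succ * z 0 - z j₀.succ * w 0)
  have key := sum_mul_mdiff_eq_zero hsum n (fun j => t j * w j.succ) (fun j => -(t j * z j.succ))
    (s * w j₀.succ) (-(s * z j₀.succ))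
  rw [Fin.sum_univ_succ, Finset.sum_eq_zero, add_zero] at key
  · have hinc : (fun j => t j * w j.succ * z 0 + -(t j * z j.succ) * w 0) = hv := by
      funext j
      rw [← div_mul_cancel₀ (hv j) (hd j)]
      simp only [t]
      ring
    have hx : s * w j₀.succ * z 0 + -(s * z j₀.succ) * w 0 = x := by
      rw [← div_mul_cancel₀ x (hd j₀)]
      simp only [s]
      ring
    rw [hinc, hx] at key
    exact (mul_eq_zero.mp key).resolve_left (hu 0)
  · intro i _
    rw [mdiff_eq_zero_of_increment_eq_zero σ n _ i (by ring), mul_zero]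
end

section
/- Let N ≥ 2 and let z = (z_1,…,z_N), w = (w_1,…,w_N) ∈ ℝ^N be totally non-aligned, i.e. z_i·w_j − z_j·w_i ≠ 0 for all i ≠ j. Let σ : ℝ → ℝ be (N−1)-times continuously differentiable and suppose there exists u ∈ ℝ^N with u ≠ 0 such that ∑_{i=1}^N u_i · σ(θ₁·z_i + θ₂·w_i) = 0 for every (θ₁, θ₂) ∈ ℝ². Then the (N−1)-st derivative of σ vanishes identically, i.e. σ^{(N−1)}(x) = 0 for all x ∈ ℝ; in particular σ is a polynomial function of degree at most N − 2. -/
open Polynomial in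
/-- A function on `ℝ` whose `n`-th derivative vanishes is a polynomial of degree less than `n`. -/
theorem exists_polynomial_degree_lt_of_iteratedDeriv_eq_zero (n : ℕ) (f : ℝ → ℝ)
    (hf : ContDiff ℝ n f) (h : ∀ x, iteratedDeriv n f x = 0) :
    ∃ p : ℝ[X], p.degree < n ∧ ∀ x, f x = p.eval x := by
  induction n generalizing f with
  | zero => exact ⟨0, by simp, by simpa using h⟩
  | succ n ih =>
    have hdiff : Differentiable ℝ (iteratedDeriv n f) :=
      hf.differentiable_iteratedDeriv n (by exact_mod_cast n.lt_succ_self)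
    have hconst (x : ℝ) : iteratedDeriv n f x = iteratedDeriv n f 0 :=
      is_const_of_deriv_eq_zero hdiff (fun y => by rw [← iteratedDeriv_succ, h]) x 0
    set c : ℝ := iteratedDeriv n f 0 / n.factorial with hc
    have hfn : ContDiff ℝ n f := hf.of_le (by exact_mod_cast n.le_succ)
    have hg : ContDiff ℝ n (fun x : ℝ => c * x ^ n) := by fun_prop
    obtain ⟨p, hp, hfp⟩ := ih (fun x => f x - c * x ^ n) (hfn.sub hg) fun x => by
      rw [iteratedDeriv_fun_sub hfn.contDiffAt hg.contDiffAt, hconst, iteratedDeriv_const_mul_field,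
        iteratedDeriv_pow, Nat.descFactorial_self, Nat.sub_self, pow_zero, mul_one, hc,
        div_mul_cancel₀ _ (by exact_mod_cast n.factorial_ne_zero), sub_self]
    refine ⟨p + C c * X ^ n, ?_, fun x => ?_⟩
    · refine (degree_add_le _ _).trans_lt (max_lt (hp.trans ?_) ?_)
      · exact_mod_cast n.lt_succ_self
      · exact (degree_C_mul_X_pow_le n c).trans_lt (by exact_mod_cast n.lt_succ_self)
    · have := hfp x
      simp only [eval_add, eval_mul, eval_C, eval_pow, eval_X]
      linarith

/-- Differentiating `∑ i, u i * σ (θ₁ * z i + θ₂ * w i) = 0` once along each direction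
`(w j, -z j)`, `j ∈ T`. -/
theorem sum_mul_prod_mul_iteratedDeriv_eq_zero {ι : Type*} [Fintype ι] (z w u : ι → ℝ)
    (σ : ℝ → ℝ) (hsum : ∀ θ₁ θ₂ : ℝ, ∑ i, u i * σ (θ₁ * z i + θ₂ * w i) = 0) (T : Finset ι)
    (hσ : ContDiff ℝ T.card σ) (θ₁ θ₂ : ℝ) :
    ∑ i, u i * (∏ j ∈ T, (z i * w j - z j * w i)) *
      iteratedDeriv T.card σ (θ₁ * z i + θ₂ * w i) = 0 := by
  classical
  induction T using Finset.induction_on generalizing θ₁ θ₂ with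
  | empty => simpa using hsum θ₁ θ₂
  | insert a T ha ih =>
    rw [Finset.card_insert_of_notMem ha] at hσ ⊢
    have ih := ih (hσ.of_le (by exact_mod_cast T.card.le_succ))
    have hdiff : Differentiable ℝ (iteratedDeriv T.card σ) :=
      hσ.differentiable_iteratedDeriv _ (by exact_mod_cast T.card.lt_succ_self)
    have hline (i : ι) : HasDerivAt
        (fun t : ℝ => (θ₁ + t * w a) * z i + (θ₂ - t * z a) * w i)
        (z i * w a - z a * w i) 0 := by
      have h₁ := (((hasDerivAt_id (0 : ℝ)).mul_const (w a)).const_add θ₁).mul_const (z i)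
      have h₂ := (((hasDerivAt_id (0 : ℝ)).mul_const (z a)).const_sub θ₂).mul_const (w i)
      exact (h₁.add h₂).congr_deriv (by ring)
    have hterm (i : ι) : HasDerivAt
        (fun t : ℝ => u i * (∏ j ∈ T, (z i * w j - z j * w i)) *
          iteratedDeriv T.card σ ((θ₁ + t * w a) * z i + (θ₂ - t * z a) * w i))
        (u i * (∏ j ∈ insert a T, (z i * w j - z j * w i)) *
          iteratedDeriv (T.card + 1) σ (θ₁ * z i + θ₂ * w i)) 0 := by
      have h := ((hdiff _).hasDerivAt.comp (0 : ℝ) (hline i)).const_mul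
        (u i * ∏ j ∈ T, (z i * w j - z j * w i))
      refine h.congr_deriv ?_
      rw [Finset.prod_insert ha, iteratedDeriv_succ]
      simp only [zero_mul, add_zero, sub_zero]
      ring
    have htotal := HasDerivAt.fun_sum (u := Finset.univ) fun i _ => hterm i
    simp only [ih] at htotal
    exact htotal.unique (hasDerivAt_const 0 0)

theorem stmt6 (N : ℕ) (hN : 2 ≤ N) (z w : Fin N → ℝ)
    (hzw : ∀ i j : Fin N, i ≠ j → z i * w j - z j * w i ≠ 0)
    (σ : ℝ → ℝ) (hσ : ContDiff ℝ (N - 1 : ℕ) σ)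
    (u : Fin N → ℝ) (hu : u ≠ 0)
    (hsum : ∀ θ₁ θ₂ : ℝ, ∑ i, u i * σ (θ₁ * z i + θ₂ * w i) = 0) :
    (∀ x : ℝ, iteratedDeriv (N - 1) σ x = 0) ∧
      ∃ p : Polynomial ℝ, p.degree ≤ (N - 2 : ℕ) ∧ ∀ x : ℝ, σ x = p.eval x := by
  obtain ⟨k, hk⟩ := Function.ne_iff.mp hu
  have hcard : (Finset.univ.erase k).card = N - 1 := by simp
  have hderiv (x : ℝ) : iteratedDeriv (N - 1) σ x = 0 := by
    obtain ⟨θ₁, θ₂, hθ⟩ : ∃ θ₁ θ₂ : ℝ, θ₁ * z k + θ₂ * w k = x := by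
      have : Nontrivial (Fin N) := Fin.nontrivial_iff_two_le.mpr hN
      obtain ⟨j, hj⟩ := exists_ne k
      have hkj := hzw k j hj.symm
      refine ⟨x * w j / (z k * w j - z j * w k), -(x * z j) / (z k * w j - z j * w k), ?_⟩
      rw [div_mul_eq_mul_div, div_mul_eq_mul_div, ← add_div, div_eq_iff hkj]
      ring
    have h := sum_mul_prod_mul_iteratedDeriv_eq_zero z w u σ hsum (Finset.univ.erase k)
      (by rwa [hcard]) θ₁ θ₂
    rw [hcard, Finset.sum_eq_single k, hθ] at h
    · refine (mul_eq_zero.mp h).resolve_left (mul_ne_zero hk (Finset.prod_ne_zero_iff.mpr ?_))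
      exact fun j hj => hzw k j (Finset.ne_of_mem_erase hj).symm
    · intro i _ hi
      rw [Finset.prod_eq_zero (Finset.mem_erase.mpr ⟨hi, Finset.mem_univ i⟩) (sub_self _)]
      simp
    · simp
  refine ⟨hderiv, ?_⟩
  obtain ⟨p, hp, hσp⟩ := exists_polynomial_degree_lt_of_iteratedDeriv_eq_zero _ σ hσ hderiv
  refine ⟨p, Polynomial.degree_le_of_natDegree_le ?_, hσp⟩
  rcases eq_or_ne p 0 with rfl | hp0
  · simp
  · have := (Polynomial.natDegree_lt_iff_degree_lt hp0).mpr hp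
    omega
end

section
/- Let N ≥ 1, let A be an invertible real N×N matrix, let β ∈ ℝ, and let σ : ℝ → ℝ be continuous and not constant. Assume that for all i, j ∈ {1,…,N} the function z ↦ σ((Az)_i)·σ((Az)_j) is integrable with respect to γ_N. Then the symmetric N×N matrix K defined by K_{ij} = ∫_{ℝ^N} σ((Az)_i)·σ((Az)_j) dγ_N(z) + β² is strictly positive definite. -/
open MeasureTheory ProbabilityTheory

/-- The standard Gaussian measure on `ℝ^m`, the `m`-fold product of `N(0,1)`. -/
noncomputable def stdGaussian (m : ℕ) : Measure (Fin m → ℝ) :=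
  Measure.pi fun _ => gaussianReal 0 1

instance gaussianReal_one_isOpenPosMeasure (μ : ℝ) : (gaussianReal μ 1).IsOpenPosMeasure :=
  (gaussianReal_absolutelyContinuous' μ one_ne_zero).isOpenPosMeasure

instance stdGaussian_isOpenPosMeasure (m : ℕ) : (stdGaussian m).IsOpenPosMeasure := by
  unfold _root_.stdGaussian
  infer_instance

/-- The coordinate functions `y ↦ σ (y i)` are linearly independent if `σ` is not constant. -/
lemma exists_sum_mul_comp_ne_zero {ι : Type*} [Fintype ι] {σ : ℝ → ℝ}
    (hconst : ¬ ∃ c : ℝ, ∀ x : ℝ, σ x = c) {u : ι → ℝ} (hu : u ≠ 0) :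
    ∃ y : ι → ℝ, ∑ i, u i * σ (y i) ≠ 0 := by
  classical
  by_contra! h
  obtain ⟨k, hk⟩ := Function.ne_iff.mp hu
  refine hconst ⟨σ 0, fun x => ?_⟩
  have hx := h (Function.update 0 k x)
  rw [← h 0, ← sub_eq_zero, ← Finset.sum_sub_distrib,
    Finset.sum_eq_single k (fun i _ hi => by simp [hi]) (by simp)] at hx
  have hx' : u k * (σ x - σ 0) = 0 := by simpa [mul_sub] using hx
  exact sub_eq_zero.mp ((mul_eq_zero.mp hx').resolve_left hk)

theorem stmt9 (N : ℕ) (hN : 1 ≤ N) (A : Matrix (Fin N) (Fin N) ℝ)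
    (hA : IsUnit A.det) (β : ℝ)
    (σ : ℝ → ℝ) (hσ : Continuous σ) (hconst : ¬ ∃ c : ℝ, ∀ x : ℝ, σ x = c)
    (hint : ∀ i j : Fin N, Integrable
      (fun z : Fin N → ℝ => σ (A.mulVec z i) * σ (A.mulVec z j)) (stdGaussian N)) :
    ∀ u : Fin N → ℝ, u ≠ 0 →
      0 < ∑ i, ∑ j, u i *
        ((∫ z, σ (A.mulVec z i) * σ (A.mulVec z j) ∂(stdGaussian N)) + β ^ 2) * u j := by
  intro u hu
  set F : (Fin N → ℝ) → ℝ := fun z => ∑ i, u i * σ (A.mulVec z i) with hF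
  have hF_sq : (fun z => F z ^ 2) = fun z =>
      ∑ i, ∑ j, u i * u j * (σ (A.mulVec z i) * σ (A.mulVec z j)) := by
    funext z
    simp only [hF, sq, Finset.sum_mul_sum]
    exact Finset.sum_congr rfl fun i _ => Finset.sum_congr rfl fun j _ => by ring
  have hF_int : Integrable (fun z => F z ^ 2) (stdGaussian N) := by
    rw [hF_sq]
    exact integrable_finsetSum _ fun i _ => integrable_finsetSum _ fun j _ =>
      (hint i j).const_mul _
  have hF_cont : Continuous F := by
    have hmul : Continuous fun z : Fin N → ℝ => A.mulVec z :=
      continuous_const.matrix_mulVec continuous_id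
    exact continuous_finsetSum _ fun i _ =>
      continuous_const.mul (hσ.comp ((continuous_apply i).comp hmul))
  obtain ⟨y, hy⟩ := exists_sum_mul_comp_ne_zero hconst hu
  have hF_ne : F (A⁻¹.mulVec y) ≠ 0 := by
    simpa [hF, Matrix.mulVec_mulVec, Matrix.mul_nonsing_inv A hA] using hy
  have hpos : 0 < ∫ z, F z ^ 2 ∂(stdGaussian N) :=
    integral_pos_of_integrable_nonneg_nonzero (hF_cont.pow 2) hF_int (fun z => sq_nonneg (F z))
      (pow_ne_zero 2 hF_ne)
  have hF_integral : ∫ z, F z ^ 2 ∂(stdGaussian N) = ∑ i, ∑ j, u i * u j *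
      ∫ z, σ (A.mulVec z i) * σ (A.mulVec z j) ∂(stdGaussian N) := by
    rw [hF_sq, integral_finsetSum _ fun i _ => integrable_finsetSum _ fun j _ =>
      (hint i j).const_mul _]
    refine Finset.sum_congr rfl fun i _ => ?_
    rw [integral_finsetSum _ fun j _ => (hint i j).const_mul _]
    exact Finset.sum_congr rfl fun j _ => integral_const_mul _ _
  have hsplit : ∑ i, ∑ j, u i *
        ((∫ z, σ (A.mulVec z i) * σ (A.mulVec z j) ∂(stdGaussian N)) + β ^ 2) * u j
      = ∫ z, F z ^ 2 ∂(stdGaussian N) + (β * ∑ i, u i) ^ 2 := by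
    rw [hF_integral, mul_pow, sq (∑ i, u i), Finset.sum_mul_sum, Finset.mul_sum,
      ← Finset.sum_add_distrib]
    refine Finset.sum_congr rfl fun i _ => ?_
    rw [Finset.mul_sum, ← Finset.sum_add_distrib]
    exact Finset.sum_congr rfl fun j _ => by ring
  rw [hsplit]
  positivity
end

section
/- Let x_1, …, x_N ∈ ℝ^{n₀} be pairwise distinct, let α ≠ 0 and β ≠ 0 be reals, and let σ : ℝ → ℝ be continuous and not a polynomial function. Let Ã be the N×(n₀+1) real matrix whose i-th row is (α·x_iᵀ, β). Assume that for all i, j ∈ {1,…,N} the function w ↦ σ((Ãw)_i)·σ((Ãw)_j) is integrable with respect to γ_{n₀+1}. Then the symmetric N×N matrix K defined by K_{ij} = ∫_{ℝ^{n₀+1}} σ((Ãw)_i)·σ((Ãw)_j) dγ_{n₀+1}(w) + β² is strictly positive definite. -/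
open MeasureTheory ProbabilityTheory

open Polynomial in
/-- A function with vanishing `m`-th forward difference of step `h` is polynomial on every
progression `y, y + h, y + 2 h, …`. -/
theorem exists_polynomial_of_fwdDiff_iter_eq_zero {f : ℝ → ℝ} {m : ℕ} {h : ℝ}
    (hf : (fwdDiff h)^[m] f = 0) (y : ℝ) :
    ∃ p : ℝ[X], ∀ n : ℕ, f (y + n * h) = p.eval (n : ℝ) := by
  have hzero : ∀ k, m ≤ k → (fwdDiff h)^[k] f y = 0 := by
    intro k hk
    obtain ⟨j, rfl⟩ := Nat.exists_eq_add_of_le' hk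
    rw [Function.iterate_add_apply, hf]
    have : ∀ j : ℕ, (fwdDiff h)^[j] (0 : ℝ → ℝ) = 0 := fun j =>
      Function.iterate_fixed (by ext; simp [fwdDiff]) j
    simp [this]
  refine ⟨∑ k ∈ Finset.range m,
    C ((fwdDiff h)^[k] f y / (k.factorial : ℝ)) * descPochhammer ℝ k, fun n => ?_⟩
  have hshift := shift_eq_sum_fwdDiff_iter h f n y
  rw [nsmul_eq_mul] at hshift
  rw [hshift, eval_finsetSum]
  have hchoose : ∀ k, (C ((fwdDiff h)^[k] f y / (k.factorial : ℝ)) * descPochhammer ℝ k).eval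
      (n : ℝ) = n.choose k • (fwdDiff h)^[k] f y := by
    intro k
    have hk : (k.factorial : ℝ) ≠ 0 := by positivity
    rw [eval_mul, eval_C, descPochhammer_eval_eq_descFactorial,
      Nat.descFactorial_eq_factorial_mul_choose, nsmul_eq_mul]
    push_cast
    field_simp
  simp_rw [hchoose]
  rcases le_total m (n + 1) with hmn | hmn
  · refine (Finset.sum_subset (Finset.range_subset_range.2 hmn) fun k _ hk => ?_).symm
    rw [hzero k (by simpa only [Finset.mem_range, not_lt] using hk), smul_zero]
  · refine Finset.sum_subset (Finset.range_subset_range.2 hmn) fun k _ hk => ?_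
    have hnk : n + 1 ≤ k := by simpa only [Finset.mem_range, not_lt] using hk
    rw [Nat.choose_eq_zero_of_lt hnk, zero_smul]

open Polynomial in
/-- A continuous function all of whose `m`-th forward differences vanish is polynomial on every
half-line. -/
theorem exists_polynomial_on_Ici_of_fwdDiff_iter_eq_zero {f : ℝ → ℝ} (hc : Continuous f) {m : ℕ}
    (hf : ∀ h : ℝ, (fwdDiff h)^[m] f = 0) (y : ℝ) :
    ∃ p : ℝ[X], ∀ t, y ≤ t → f t = p.eval t := by
  have hstep : ∀ d : ℕ, d ≠ 0 → ∃ p : ℝ[X], ∀ n : ℕ, f (y + n / d) = p.eval (y + n / d : ℝ) := by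
    intro d hd
    obtain ⟨p, hp⟩ := exists_polynomial_of_fwdDiff_iter_eq_zero (hf (1 / d)) y
    refine ⟨p.comp (C (d : ℝ) * (X - C y)), fun n => ?_⟩
    have hd' : (d : ℝ) ≠ 0 := Nat.cast_ne_zero.2 hd
    have := hp n
    rw [mul_one_div] at this
    rw [this, eval_comp]
    congr 1
    simp
    field_simp
  obtain ⟨p, hp⟩ := hstep 1 one_ne_zero
  have hrat : ∀ d : ℕ, d ≠ 0 → ∀ n : ℕ, f (y + n / d) = p.eval (y + n / d : ℝ) := by
    intro d hd n
    obtain ⟨q, hq⟩ := hstep d hd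
    suffices q = p by rw [← this]; exact hq n
    refine eq_of_infinite_eval_eq q p ?_
    refine (Set.infinite_range_of_injective (f := fun n : ℕ => y + (n : ℝ)) fun a b hab => by
      simpa using hab).mono ?_
    rintro _ ⟨k, rfl⟩
    have hd' : (d : ℝ) ≠ 0 := Nat.cast_ne_zero.2 hd
    have hk := hq (k * d)
    have hk' := hp k
    push_cast at hk hk'
    rw [mul_div_cancel_right₀ _ hd'] at hk
    rw [div_one] at hk'
    exact hk.symm.trans hk'
  refine ⟨p, fun t ht => ?_⟩
  have hlim : Filter.Tendsto (fun d : ℕ => y + (⌊(t - y) * (d : ℝ)⌋₊ : ℝ) / d) Filter.atTop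
      (nhds t) := by
    have := ((tendsto_nat_floor_mul_div_atTop (sub_nonneg.2 ht)).comp
      tendsto_natCast_atTop_atTop).const_add y
    rwa [add_sub_cancel] at this
  refine tendsto_nhds_unique ((hc.tendsto t).comp hlim)
    (((p.continuous.tendsto t).comp hlim).congr' ?_)
  filter_upwards [Filter.eventually_ne_atTop 0] with d hd
  exact (hrat d hd _).symm

open Polynomial in
/-- **Fréchet's theorem**: a continuous function all of whose `m`-th forward differences vanish is
a polynomial function. -/
theorem exists_polynomial_of_forall_fwdDiff_iter_eq_zero {f : ℝ → ℝ} (hc : Continuous f) {m : ℕ}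
    (hf : ∀ h : ℝ, (fwdDiff h)^[m] f = 0) :
    ∃ p : ℝ[X], ∀ t, f t = p.eval t := by
  obtain ⟨p, hp⟩ := exists_polynomial_on_Ici_of_fwdDiff_iter_eq_zero hc hf 0
  refine ⟨p, fun t => ?_⟩
  obtain ⟨q, hq⟩ := exists_polynomial_on_Ici_of_fwdDiff_iter_eq_zero hc hf t
  suffices q = p by rw [← this]; exact hq t le_rfl
  refine eq_of_infinite_eval_eq q p ((Set.Ici_infinite (max t 0)).mono fun s hs => ?_)
  rw [Set.mem_Ici, max_le_iff] at hs
  exact (hq s hs.1).symm.trans (hp s hs.2)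

/-- If ridge functions with pairwise distinct directions, shifted by a common variable, sum to
zero, then each summand is annihilated by iterated forward differences. -/
theorem fwdDiff_iter_eq_zero_of_sum_ridge_eq_zero {ι : Type*} [DecidableEq ι] {d : ℕ}
    (c : ι → Fin d → ℝ) (k : ι) (S : Finset ι) (hS : ∀ i ∈ S, c i ≠ c k) (g : ι → ℝ → ℝ)
    (hg : ∀ (t : Fin d → ℝ) (s : ℝ),
      g k (c k ⬝ᵥ t + s) + ∑ i ∈ S, g i (c i ⬝ᵥ t + s) = 0) (h : ℝ) :
    (fwdDiff h)^[S.card] (g k) = 0 := by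
  induction S using Finset.induction_on generalizing g with
  | empty =>
    ext s
    simpa using hg 0 s
  | insert a S ha ih =>
    rw [Finset.card_insert_of_notMem ha, Function.iterate_succ_apply]
    have hak : c k - c a ≠ 0 := sub_ne_zero.2 (hS a (Finset.mem_insert_self a S)).symm
    have hpos : (c k - c a) ⬝ᵥ (c k - c a) ≠ 0 := fun h0 => hak (dotProduct_self_eq_zero.1 h0)
    set v : Fin d → ℝ := (h / ((c k - c a) ⬝ᵥ (c k - c a))) • (c k - c a) with hv
    have hkv : (c k - c a) ⬝ᵥ v = h := by
      rw [hv, dotProduct_smul, smul_eq_mul, div_mul_cancel₀ _ hpos]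
    have key := ih (fun i hi => hS i (Finset.mem_insert_of_mem hi))
      (fun j => fwdDiff ((c j - c a) ⬝ᵥ v) (g j)) ?_
    · simpa only [hkv] using key
    · intro t s
      have h1 := hg (t + v) (s - c a ⬝ᵥ v)
      have h2 := hg t s
      have harg : ∀ j, c j ⬝ᵥ (t + v) + (s - c a ⬝ᵥ v) = c j ⬝ᵥ t + s + (c j - c a) ⬝ᵥ v := by
        intro j
        rw [dotProduct_add, sub_dotProduct]
        ring
      rw [Finset.sum_insert ha] at h1 h2
      simp only [harg, sub_self, zero_dotProduct, add_zero] at h1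
      simp only [fwdDiff, Finset.sum_sub_distrib]
      linarith

/-- A continuous non-polynomial function composed with affine forms having pairwise distinct linear
parts yields linearly independent functions. -/
theorem exists_sum_ridge_ne_zero {ι : Type*} [Fintype ι] {d : ℕ} {c : ι → Fin d → ℝ}
    (hc : Function.Injective c) {σ : ℝ → ℝ} (hσ : Continuous σ)
    (hpoly : ¬ ∃ p : Polynomial ℝ, ∀ t : ℝ, σ t = p.eval t) {u : ι → ℝ} (hu : u ≠ 0) :
    ∃ (t : Fin d → ℝ) (s : ℝ), ∑ i, u i * σ (c i ⬝ᵥ t + s) ≠ 0 := by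
  classical
  by_contra! hzero
  obtain ⟨k, hk⟩ := Function.ne_iff.1 hu
  have hdiff := fwdDiff_iter_eq_zero_of_sum_ridge_eq_zero c k (Finset.univ.erase k)
    (fun i hi => hc.ne (Finset.ne_of_mem_erase hi)) (fun i s => u i * σ s) fun t s => by
      rw [Finset.add_sum_erase _ (fun i => u i * σ (c i ⬝ᵥ t + s)) (Finset.mem_univ k)]
      exact hzero t s
  obtain ⟨p, hp⟩ := exists_polynomial_of_forall_fwdDiff_iter_eq_zero
    (continuous_const.mul hσ) hdiff
  refine hpoly ⟨Polynomial.C (u k)⁻¹ * p, fun t => ?_⟩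
  rw [Polynomial.eval_mul, Polynomial.eval_C, ← hp t]
  exact (inv_mul_cancel_left₀ hk (σ t)).symm

instance isOpenPosMeasure_stdGaussian (m : ℕ) : (stdGaussian m).IsOpenPosMeasure := by
  have : (gaussianReal 0 1).IsOpenPosMeasure :=
    (gaussianReal_absolutelyContinuous' 0 one_ne_zero).isOpenPosMeasure
  unfold _root_.stdGaussian
  infer_instance

theorem stmt10 (N n₀ : ℕ) (x : Fin N → (Fin n₀ → ℝ))
    (hx : ∀ i j : Fin N, i ≠ j → x i ≠ x j)
    (α β : ℝ) (hα : α ≠ 0) (hβ : β ≠ 0)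
    (σ : ℝ → ℝ) (hσ : Continuous σ)
    (hpoly : ¬ ∃ p : Polynomial ℝ, ∀ t : ℝ, σ t = p.eval t)
    (A : Matrix (Fin N) (Fin (n₀ + 1)) ℝ)
    (hA : ∀ i : Fin N, A i = Fin.snoc (fun j => α * x i j) β)
    (hint : ∀ i j : Fin N, Integrable
      (fun w : Fin (n₀ + 1) → ℝ => σ (A.mulVec w i) * σ (A.mulVec w j))
      (stdGaussian (n₀ + 1))) :
    ∀ u : Fin N → ℝ, u ≠ 0 →
      0 < ∑ i, ∑ j, u i *
        ((∫ w, σ (A.mulVec w i) * σ (A.mulVec w j) ∂(stdGaussian (n₀ + 1))) + β ^ 2) * u j := by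
  intro u hu
  have hsum : ∀ (F : Fin N → ℝ), ∑ i, ∑ j, u i * (F i * F j) * u j = (∑ i, u i * F i) ^ 2 := by
    intro F
    rw [sq, Finset.sum_mul_sum]
    exact Finset.sum_congr rfl fun i _ => Finset.sum_congr rfl fun j _ => by ring
  have hintegrable : ∀ i j, Integrable
      (fun w => u i * (σ (A.mulVec w i) * σ (A.mulVec w j)) * u j) (stdGaussian (n₀ + 1)) :=
    fun i j => ((hint i j).const_mul _).mul_const _
  have hsq_integrable : Integrable (fun w => (∑ i, u i * σ (A.mulVec w i)) ^ 2)
      (stdGaussian (n₀ + 1)) := by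
    simp_rw [← hsum]
    exact integrable_finsetSum _ fun i _ => integrable_finsetSum _ fun j _ => hintegrable i j
  have hquad : ∑ i, ∑ j, u i *
      ((∫ w, σ (A.mulVec w i) * σ (A.mulVec w j) ∂(stdGaussian (n₀ + 1))) + β ^ 2) * u j =
      (∫ w, (∑ i, u i * σ (A.mulVec w i)) ^ 2 ∂(stdGaussian (n₀ + 1))) + (∑ i, u i * β) ^ 2 := by
    simp_rw [← hsum, mul_add, add_mul, Finset.sum_add_distrib]
    rw [integral_finsetSum _ fun i _ => integrable_finsetSum _ fun j _ => hintegrable i j]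
    simp_rw [integral_finsetSum _ fun j _ => hintegrable _ j, integral_mul_const,
      integral_const_mul, sq]
  rw [hquad]
  have hinj : Function.Injective fun i => α • x i := fun i j hij => by
    by_contra hne
    exact hx i j hne (smul_right_injective _ hα hij)
  obtain ⟨t, s, hts⟩ := exists_sum_ridge_ne_zero hinj hσ hpoly hu
  refine add_pos_of_pos_of_nonneg
    (integral_pos_of_integrable_nonneg_nonzero (x := Fin.snoc t (s / β)) ?_ hsq_integrable
      (fun w => sq_nonneg _) ?_) (sq_nonneg _)
  · refine (continuous_finsetSum _ fun i _ => continuous_const.mul (hσ.comp ?_)).pow 2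
    exact (continuous_apply i).comp (continuous_const.matrix_mulVec continuous_id)
  · have harg : ∀ i, A.mulVec (Fin.snoc t (s / β)) i = (α • x i) ⬝ᵥ t + s := by
      intro i
      rw [Matrix.mulVec, hA, dotProduct, Fin.sum_univ_castSucc]
      simp [dotProduct, mul_div_cancel₀ _ hβ]
    simp_rw [harg]
    exact pow_ne_zero 2 hts
end

section
/- Let B be a real N×r matrix whose rows are pairwise non-proportional, i.e. for i ≠ j there is no scalar λ ∈ ℝ with row_i(B) = λ·row_j(B) or row_j(B) = λ·row_i(B). Then there exist y₁, y₂ ∈ ℝ^r such that the vectors z = By₁ and w = By₂ in ℝ^N are totally non-aligned, i.e. z_i·w_j − z_j·w_i ≠ 0 for all i ≠ j. -/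
/-- Finitely many nonzero real vectors admit a common vector orthogonal to none of them. -/
theorem exists_forall_dotProduct_ne_zero {ι n : Type*} [Finite ι] [Fintype n]
    (v : ι → n → ℝ) (hv : ∀ i, v i ≠ 0) : ∃ y : n → ℝ, ∀ i, v i ⬝ᵥ y ≠ 0 := by
  classical
  obtain ⟨y, hy⟩ := Module.Dual.exists_forall_ne_zero_of_forall_exists
    (fun i => dotProductEquiv ℝ n (v i))
    (fun i => ⟨v i, by simpa [dotProduct_self_eq_zero] using hv i⟩)
  exact ⟨y, fun i => by simpa using hy i⟩

theorem stmt14 (N r : ℕ) (B : Matrix (Fin N) (Fin r) ℝ)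
    (hB : ∀ i j : Fin N, i ≠ j → ¬ ∃ lam : ℝ, B i = lam • B j ∨ B j = lam • B i) :
    ∃ y₁ y₂ : Fin r → ℝ, ∀ i j : Fin N, i ≠ j →
      B.mulVec y₁ i * B.mulVec y₂ j - B.mulVec y₁ j * B.mulVec y₂ i ≠ 0 := by
  obtain ⟨y₁, hy₁⟩ := exists_forall_dotProduct_ne_zero
    (fun p : {p : Fin N × Fin N // p.1 ≠ p.2} => B p.1.1)
    (fun p h => hB _ _ p.2 ⟨0, Or.inl (by simpa using h)⟩)
  obtain ⟨y₂, hy₂⟩ := exists_forall_dotProduct_ne_zero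
    (fun p : {p : Fin N × Fin N // p.1 ≠ p.2} =>
      (B p.1.1 ⬝ᵥ y₁) • B p.1.2 - (B p.1.2 ⬝ᵥ y₁) • B p.1.1)
    (fun p h => hB _ _ p.2 ⟨(B p.1.1 ⬝ᵥ y₁)⁻¹ * (B p.1.2 ⬝ᵥ y₁), Or.inr (by
      rw [mul_smul, ← sub_eq_zero.mp h, inv_smul_smul₀ (hy₁ p)])⟩)
  refine ⟨y₁, y₂, fun i j hij => ?_⟩
  simpa [Matrix.mulVec, sub_dotProduct, smul_dotProduct] using hy₂ ⟨(i, j), hij⟩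
end
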